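/- Let A be a two-player game arena with position set Pos and let T be an attack tree with n leaves. The strategy semantics [[T]]^strat of T over A is nonempty if and only if there exist a position v and an Attacker strategy σ such that every play consistent with σ starting at v has a nonempty prefix of length at most |Pos| × n belonging to the path semantics [[T]] over A. (Correctness of the alternating guessing procedure for the Non-Emptiness problem of the strategy semantics.) -/

import Mathlib

/-! ### Words, merge, synchronized concatenation, s-trees -/

/-- The merge of two sets of words:
`P ⋈ Q = {p ∈ P : ∃ q ∈ Q, q ≼ p} ∪ {q ∈ Q : ∃ p ∈ P, p ≼ q}`. -/
def merge {α : Type*} (P Q : Set (List α)) : Set (List α) :=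
  {p | p ∈ P ∧ ∃ q ∈ Q, q <+: p} ∪ {q | q ∈ Q ∧ ∃ p ∈ P, p <+: q}

/-- Synchronized concatenation, lifted to sets of words: `π ⊙ π'` is defined when the
last letter of `π` equals the first letter of `π'` and concatenates `π` with the tail of `π'`. -/
def sconcat {α : Type*} (P Q : Set (List α)) : Set (List α) :=
  {w | ∃ p ∈ P, ∃ q ∈ Q, p.getLast? = q.head? ∧ w = p ++ q.tail}

/-- An s-tree over an alphabet `α`: a nonempty set of nonempty words, closed under
nonempty prefixes, all words having the same first letter (the root). -/
def IsSTree {α : Type*} (S : Set (List α)) : Prop :=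
  S.Nonempty ∧ (∀ w ∈ S, w ≠ []) ∧
  (∀ w ∈ S, ∀ w' : List α, w' <+: w → w' ≠ [] → w' ∈ S) ∧
  (∃ a, ∀ w ∈ S, w.head? = some a)

/-- A leaf of an s-tree: a word with no proper extension in the tree. -/
def IsLeafOf {α : Type*} (S : Set (List α)) (w : List α) : Prop :=
  w ∈ S ∧ ∀ w' ∈ S, w <+: w' → w' = w

/-- The children of `w` in `S`: its minimal proper extensions in `S`. -/
def childrenOf {α : Type*} (S : Set (List α)) (w : List α) : Set (List α) :=
  {w' | w' ∈ S ∧ w <+: w' ∧ w' ≠ w ∧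
    ∀ w'' ∈ S, w <+: w'' → w'' <+: w' → w'' = w ∨ w'' = w'}

/-- `S'` is a prefix of the s-tree `S`: `S'` is an s-tree with the same root,
`S' ⊆ S`, and every non-leaf of `S'` has the same children in `S'` as in `S`. -/
def TreePrefix {α : Type*} (S' S : Set (List α)) : Prop :=
  IsSTree S' ∧ (∃ a, [a] ∈ S' ∧ [a] ∈ S) ∧ S' ⊆ S ∧
  ∀ w ∈ S', ¬ IsLeafOf S' w → childrenOf S' w = childrenOf S w

/-! ### Transition systems and attack trees -/

/-- A transition system over propositions `π` with states `σ`. -/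
structure TSys (σ π : Type*) where
  step : σ → σ → Prop
  val : σ → Set π

/-- A path of a transition system: a nonempty finite sequence of states related by `step`. -/
def IsTPath {σ π : Type*} (T : TSys σ π) (w : List σ) : Prop :=
  w ≠ [] ∧ List.Chain' T.step w

/-- Attack trees: a leaf is a Boolean formula, identified with the set of states where
it holds; inner nodes are `OR`, `SAND` and `AND` operators. -/
inductive ATree (σ : Type*) where
  | leaf (F : Set σ)
  | or (t₁ t₂ : ATree σ)
  | sand (t₁ t₂ : ATree σ)
  | and (t₁ t₂ : ATree σ)

/-- The number of leaves of an attack tree. -/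
def numLeaves {σ : Type*} : ATree σ → ℕ
  | .leaf _ => 1
  | .or t₁ t₂ => numLeaves t₁ + numLeaves t₂
  | .sand t₁ t₂ => numLeaves t₁ + numLeaves t₂
  | .and t₁ t₂ => numLeaves t₁ + numLeaves t₂

/-- The path semantics of an attack tree over a transition system. -/
def pathSem {σ π : Type*} (T : TSys σ π) : ATree σ → Set (List σ)
  | .leaf F => {w | IsTPath T w ∧ ∃ s ∈ F, w.getLast? = some s}
  | .or t₁ t₂ => pathSem T t₁ ∪ pathSem T t₂
  | .sand t₁ t₂ => sconcat (pathSem T t₁) (pathSem T t₂)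
  | .and t₁ t₂ => merge (pathSem T t₁) (pathSem T t₂)

/-! ### Two-player game arenas -/

/-- A two-player concurrent game arena: a total transition function on positions given
joint actions of the two players, and a valuation of positions by atomic propositions. -/
structure Arena (Pos Act₁ Act₂ Prp : Type*) where
  delta : Pos → Act₁ × Act₂ → Pos
  val : Pos → Set Prp

variable {Pos Act₁ Act₂ Prp : Type*}

/-- A play: an infinite sequence of positions, each next one reached by some joint action. -/
def IsPlay (A : Arena Pos Act₁ Act₂ Prp) (ρ : ℕ → Pos) : Prop :=
  ∀ i : ℕ, ∃ a : Act₁ × Act₂, ρ (i + 1) = A.delta (ρ i) a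

/-- The prefix of length `n` of a play. -/
def playPrefix (ρ : ℕ → Pos) (n : ℕ) : List Pos :=
  (List.range n).map ρ

/-- Consistency of a history with a strategy `σ` of the player whose actions are extracted
from joint actions by `proj` (`Prod.fst` for Player 1/Attacker, `Prod.snd` for Player 2). -/
def ConsistHist {Act : Type*} (A : Arena Pos Act₁ Act₂ Prp) (proj : Act₁ × Act₂ → Act)
    (σ : List Pos → Act) (w : List Pos) : Prop :=
  ∀ (j : ℕ) (h : j + 1 < w.length),
    ∃ a : Act₁ × Act₂,
      A.delta (w[j]'(Nat.lt_of_succ_lt h)) a = w[j + 1]'h ∧ proj a = σ (w.take (j + 1))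

/-- A play is consistent with a strategy if all its nonempty finite prefixes are. -/
def ConsistPlay {Act : Type*} (A : Arena Pos Act₁ Act₂ Prp) (proj : Act₁ × Act₂ → Act)
    (σ : List Pos → Act) (ρ : ℕ → Pos) : Prop :=
  ∀ n : ℕ, ConsistHist A proj σ (playPrefix ρ n)

/-- A history: a nonempty finite prefix of a play. -/
def IsHist (A : Arena Pos Act₁ Act₂ Prp) (w : List Pos) : Prop :=
  ∃ ρ, IsPlay A ρ ∧ ∃ n, 1 ≤ n ∧ w = playPrefix ρ n

/-- `Hist A v`: the histories starting at position `v`. -/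
def Hist (A : Arena Pos Act₁ Act₂ Prp) (v : Pos) : Set (List Pos) :=
  {w | ∃ ρ, IsPlay A ρ ∧ ρ 0 = v ∧ ∃ n, 1 ≤ n ∧ w = playPrefix ρ n}

/-- `Prefixes(Out(σ))`: nonempty finite prefixes of plays consistent with `σ`. -/
def PrefixesOut {Act : Type*} (A : Arena Pos Act₁ Act₂ Prp) (proj : Act₁ × Act₂ → Act)
    (σ : List Pos → Act) : Set (List Pos) :=
  {w | ∃ ρ, IsPlay A ρ ∧ ConsistPlay A proj σ ρ ∧ ∃ n, 1 ≤ n ∧ w = playPrefix ρ n}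

/-- The s-tree associated with a strategy `σ` from position `v`:
`S^σ_v = Prefixes(Out(σ)) ∩ Hist(A, v)`. -/
def STree {Act : Type*} (A : Arena Pos Act₁ Act₂ Prp) (proj : Act₁ × Act₂ → Act)
    (σ : List Pos → Act) (v : Pos) : Set (List Pos) :=
  PrefixesOut A proj σ ∩ Hist A v

/-- The transition system induced by a game arena: `(v, v')` is a transition iff
`δ(v, a) = v'` for some joint action `a`. -/
def arenaTS (A : Arena Pos Act₁ Act₂ Prp) : TSys Pos Prp :=
  ⟨fun v v' => ∃ a : Act₁ × Act₂, A.delta v a = v', A.val⟩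

/-- An Attacker strategy is winning for the reachability game `(A, R)` from `v` if every
play consistent with it starting at `v` visits a position of `R`. -/
def WinningFrom (A : Arena Pos Act₁ Act₂ Prp) (σ : List Pos → Act₁) (v : Pos)
    (R : Set Pos) : Prop :=
  ∀ ρ : ℕ → Pos, IsPlay A ρ → ConsistPlay A Prod.fst σ ρ → ρ 0 = v → ∃ i, ρ i ∈ R

/-- A witness of an Attacker strategy `σ` from `v` for the reachability set `R`:
a finite prefix of `S^σ_v` all of whose leaves end in a position of `R`. -/
def Witness (A : Arena Pos Act₁ Act₂ Prp) (σ : List Pos → Act₁) (v : Pos) (R : Set Pos)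
    (S : Set (List Pos)) : Prop :=
  S.Finite ∧ TreePrefix S (STree A Prod.fst σ v) ∧
  ∀ w, IsLeafOf S w → ∃ p ∈ R, w.getLast? = some p

/-- An s-tree over `Pos` is well-formed if it is a prefix of `S^σ_v` for some Attacker
strategy `σ` and position `v`. -/
def WellFormed (A : Arena Pos Act₁ Act₂ Prp) (S : Set (List Pos)) : Prop :=
  ∃ (σ : List Pos → Act₁) (v : Pos), TreePrefix S (STree A Prod.fst σ v)

/-- The strategy semantics of an attack tree `t` over the arena `A`: the set of all
well-formed `t`-s-trees, i.e. well-formed finite s-trees all of whose leaves belong to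
the path semantics of `t` over the transition system induced by `A`. -/
def stratSem (A : Arena Pos Act₁ Act₂ Prp) (t : ATree Pos) : Set (Set (List Pos)) :=
  {S | WellFormed A S ∧ S.Finite ∧ IsSTree S ∧
    ∀ w, IsLeafOf S w → w ∈ pathSem (arenaTS A) t}

/-! ### Residuals of attack trees -/

open scoped Classical in
/-- The residual of an attack tree after reading one position: `none` if the position completes
a word of the path semantics, otherwise the attack tree that remains to be matched. -/
noncomputable def ATree.residual {σ : Type*} : ATree σ → σ → Option (ATree σ)
  | .leaf F, v => if v ∈ F then none else some (.leaf F)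
  | .or a b, v =>
    match a.residual v, b.residual v with
    | some a', some b' => some (.or a' b')
    | _, _ => none
  | .sand a b, v =>
    match a.residual v with
    | some a' => some (.sand a' b)
    | none => b.residual v
  | .and a b, v =>
    match a.residual v, b.residual v with
    | some a', some b' => some (.and a' b')
    | some a', none => some a'
    | none, r => r

theorem numLeaves_pos {σ : Type*} (t : ATree σ) : 0 < numLeaves t := by
  induction t <;> simp only [numLeaves] <;> omega

/-- A residual is the tree itself or has strictly fewer leaves. -/
theorem ATree.residual_eq_or_numLeaves_lt {σ : Type*} {t t' : ATree σ} {v : σ}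
    (h : t.residual v = some t') : t' = t ∨ numLeaves t' < numLeaves t := by
  induction t generalizing t' with
  | leaf F => grind [ATree.residual]
  | or a b iha ihb => grind [ATree.residual, numLeaves]
  | sand a b iha ihb => grind [ATree.residual, numLeaves, numLeaves_pos]
  | and a b iha ihb => grind [ATree.residual, numLeaves, numLeaves_pos]

/-- The residual after reading one position, where `none` is absorbing. -/
noncomputable def residualStep {σ : Type*} (r : Option (ATree σ)) (v : σ) : Option (ATree σ) :=
  r.bind fun t => t.residual v

/-- The residual after reading a word. -/
noncomputable def residualWord {σ : Type*} (r : Option (ATree σ)) (w : List σ) :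
    Option (ATree σ) :=
  w.foldl residualStep r

@[simp] theorem residualStep_some {σ : Type*} (t : ATree σ) (v : σ) :
    residualStep (some t) v = t.residual v := rfl

@[simp] theorem residualWord_none {σ : Type*} (w : List σ) : residualWord none w = none := by
  induction w with
  | nil => rfl
  | cons v w ih => exact ih

@[simp] theorem residualWord_nil {σ : Type*} (r : Option (ATree σ)) : residualWord r [] = r := rfl

theorem residualWord_cons {σ : Type*} (r : Option (ATree σ)) (v : σ) (w : List σ) :
    residualWord r (v :: w) = residualWord (residualStep r v) w := rfl

theorem residualWord_append {σ : Type*} (r : Option (ATree σ)) (w w' : List σ) :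
    residualWord r (w ++ w') = residualWord (residualWord r w) w' := List.foldl_append

theorem residualWord_singleton {σ : Type*} (r : Option (ATree σ)) (v : σ) :
    residualWord r [v] = residualStep r v := rfl

section PathSem

variable {σ π : Type*} {T : TSys σ π}

theorem IsTPath.of_isPrefix {w w' : List σ} (h : IsTPath T w) (hw : w' <+: w) (hne : w' ≠ []) :
    IsTPath T w' :=
  ⟨hne, by obtain ⟨y, rfl⟩ := hw; exact List.IsChain.left_of_append h.2⟩

theorem IsTPath.of_suffix {w w' : List σ} (h : IsTPath T w) (hw : w' <:+ w) (hne : w' ≠ []) :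
    IsTPath T w' :=
  ⟨hne, List.IsChain.suffix h.2 hw⟩

theorem append_tail_eq {p q : List σ} (hp : p ≠ []) (h : p.getLast? = q.head?) :
    p ++ q.tail = p.dropLast ++ q := by
  cases q with
  | nil => simp at h; exact absurd h hp
  | cons a q =>
    have := List.dropLast_append_getLast? a (by simpa using h)
    conv_lhs => rw [← this]
    simp

theorem isTPath_append_tail {p q : List σ} (hp : IsTPath T p) (hq : IsTPath T q)
    (h : p.getLast? = q.head?) : IsTPath T (p ++ q.tail) := by
  refine ⟨by simp [hp.1], ?_⟩
  cases q with
  | nil => simpa using hp.2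
  | cons a q =>
    have h2 := List.isChain_cons.1 hq.2
    refine List.isChain_append.2 ⟨hp.2, h2.2, fun x hx y hy => ?_⟩
    obtain rfl : a = x := by rw [h] at hx; simpa using hx
    exact h2.1 y hy

theorem isTPath_of_mem_pathSem {t : ATree σ} {w : List σ} (h : w ∈ pathSem T t) :
    IsTPath T w := by
  induction t generalizing w with
  | leaf F => exact h.1
  | or a b iha ihb => exact h.elim iha ihb
  | sand a b iha ihb =>
    obtain ⟨p, hp, q, hq, hpq, rfl⟩ := h
    exact isTPath_append_tail (iha hp) (ihb hq) hpq
  | and a b iha ihb => exact h.elim (fun h => iha h.1) (fun h => ihb h.1)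

/-- The path semantics is closed under extending words to the left. -/
theorem append_mem_pathSem {t : ATree σ} {q x : List σ} (hq : q ∈ pathSem T t)
    (hx : IsTPath T (x ++ q)) : x ++ q ∈ pathSem T t := by
  induction t generalizing q with
  | leaf F =>
    obtain ⟨hq, s, hs, hl⟩ := hq
    exact ⟨hx, s, hs, by simp [List.getLast?_append, hl]⟩
  | or a b iha ihb => exact hq.imp (iha · hx) (ihb · hx)
  | sand a b iha ihb =>
    obtain ⟨p, hp, q, hq, hpq, rfl⟩ := hq
    have hne := (isTPath_of_mem_pathSem hp).1
    refine ⟨x ++ p, iha hp (hx.of_isPrefix ⟨q.tail, by simp⟩ (by simp [hne])), q, hq, ?_, by simp⟩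
    obtain ⟨c, hc⟩ := Option.ne_none_iff_exists'.1 (mt List.getLast?_eq_none_iff.1 hne)
    rw [← hpq]
    simp [List.getLast?_append, hc]
  | and a b iha ihb =>
    refine hq.imp ?_ ?_
    · rintro ⟨hq, q', hq', h⟩
      have h' : x ++ q' <+: x ++ q := (List.prefix_append_right_inj x).2 h
      exact ⟨iha hq hx, x ++ q', ihb hq' (hx.of_isPrefix h'
        (by simp [(isTPath_of_mem_pathSem hq').1])), h'⟩
    · rintro ⟨hq, q', hq', h⟩
      have h' : x ++ q' <+: x ++ q := (List.prefix_append_right_inj x).2 h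
      exact ⟨ihb hq hx, x ++ q', iha hq' (hx.of_isPrefix h'
        (by simp [(isTPath_of_mem_pathSem hq').1])), h'⟩

theorem singleton_mem_pathSem {t : ATree σ} {v : σ} (h : t.residual v = none) :
    [v] ∈ pathSem T t := by
  induction t with
  | leaf F =>
    refine ⟨⟨by simp, List.isChain_singleton v⟩, v, ?_, by simp⟩
    by_contra hv
    simp [ATree.residual, hv] at h
  | or a b iha ihb =>
    simp only [ATree.residual] at h
    cases ha : a.residual v with
    | none => exact Or.inl (iha ha)
    | some a' =>
      cases hb : b.residual v with
      | none => exact Or.inr (ihb hb)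
      | some b' => simp [ha, hb] at h
  | sand a b iha ihb =>
    simp only [ATree.residual] at h
    cases ha : a.residual v with
    | none => exact ⟨[v], iha ha, [v], ihb (by simpa [ha] using h), by simp, by simp⟩
    | some a' => simp [ha] at h
  | and a b iha ihb =>
    simp only [ATree.residual] at h
    cases ha : a.residual v with
    | none => exact Or.inl ⟨iha ha, [v], ihb (by simpa [ha] using h), List.prefix_rfl⟩
    | some a' => cases hb : b.residual v <;> simp [ha, hb] at h

theorem cons_mem_pathSem {t t' : ATree σ} {v : σ} {u : List σ} (h : t.residual v = some t')
    (hu : u ∈ pathSem T t') (hv : IsTPath T (v :: u)) : v :: u ∈ pathSem T t := by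
  induction t generalizing t' u with
  | leaf F =>
    obtain rfl : ATree.leaf F = t' := by
      by_cases hF : v ∈ F
      · simp [ATree.residual, hF] at h
      · simpa [ATree.residual, hF] using h
    exact append_mem_pathSem (x := [v]) hu hv
  | or a b iha ihb =>
    simp only [ATree.residual] at h
    cases ha : a.residual v with
    | none => simp [ha] at h
    | some a' =>
      cases hb : b.residual v with
      | none => simp [ha, hb] at h
      | some b' =>
        simp only [ha, hb, Option.some.injEq] at h
        subst h
        exact hu.imp (iha ha · hv) (ihb hb · hv)
  | sand a b iha ihb =>
    simp only [ATree.residual] at h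
    cases ha : a.residual v with
    | none =>
      exact ⟨[v], singleton_mem_pathSem ha, v :: u, ihb (by simpa [ha] using h) hu hv,
        by simp, by simp⟩
    | some a' =>
      simp only [ha, Option.some.injEq] at h
      subst h
      obtain ⟨p, hp, q, hq, hpq, rfl⟩ := hu
      have hne := (isTPath_of_mem_pathSem hp).1
      refine ⟨v :: p, iha ha hp (hv.of_isPrefix ⟨q.tail, by simp⟩ (by simp)), q, hq, ?_, by simp⟩
      rw [← hpq, List.getLast?_cons_of_ne_nil hne]
  | and a b iha ihb =>
    simp only [ATree.residual] at h
    have hpre : [v] <+: v :: u := ⟨u, rfl⟩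
    cases ha : a.residual v with
    | none =>
      exact Or.inr ⟨ihb (by simpa [ha] using h) hu hv, [v], singleton_mem_pathSem ha, hpre⟩
    | some a' =>
      cases hb : b.residual v with
      | none =>
        simp only [ha, hb, Option.some.injEq] at h
        subst h
        exact Or.inl ⟨iha ha hu hv, [v], singleton_mem_pathSem hb, hpre⟩
      | some b' =>
        simp only [ha, hb, Option.some.injEq] at h
        subst h
        refine hu.imp ?_ ?_
        · rintro ⟨hu, q, hq, h⟩
          have h' : v :: q <+: v :: u := (List.prefix_cons_inj v).2 h
          exact ⟨iha ha hu hv, v :: q, ihb hb hq (hv.of_isPrefix h' (by simp)), h'⟩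
        · rintro ⟨hu, q, hq, h⟩
          have h' : v :: q <+: v :: u := (List.prefix_cons_inj v).2 h
          exact ⟨ihb hb hu hv, v :: q, iha ha hq (hv.of_isPrefix h' (by simp)), h'⟩

/-- A path whose residual is `none` has a nonempty prefix in the path semantics. -/
theorem exists_prefix_mem_pathSem {t : ATree σ} {w : List σ} (hw : IsTPath T w)
    (h : residualWord (some t) w = none) : ∃ u, u <+: w ∧ u ∈ pathSem T t := by
  induction w generalizing t with
  | nil => simp at h
  | cons v w ih =>
    rw [residualWord_cons, residualStep_some] at h
    cases ht : t.residual v with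
    | none => exact ⟨[v], ⟨w, rfl⟩, singleton_mem_pathSem ht⟩
    | some t' =>
      rw [ht] at h
      have hne : w ≠ [] := by rintro rfl; simp at h
      obtain ⟨u, hu, hut⟩ := ih (hw.of_suffix (List.suffix_cons v w) hne) h
      have hu' : v :: u <+: v :: w := (List.prefix_cons_inj v).2 hu
      exact ⟨v :: u, hu', cons_mem_pathSem ht hut (hw.of_isPrefix hu' (by simp))⟩

theorem exists_prefix_mem_pathSem_and {a b : ATree σ} {w : List σ} :
    (∃ u, u <+: w ∧ u ∈ pathSem T (.and a b)) ↔
      (∃ u, u <+: w ∧ u ∈ pathSem T a) ∧ ∃ u, u <+: w ∧ u ∈ pathSem T b := by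
  constructor
  · rintro ⟨u, hu, ⟨h, q, hq, hqu⟩ | ⟨h, q, hq, hqu⟩⟩
    · exact ⟨⟨u, hu, h⟩, q, hqu.trans hu, hq⟩
    · exact ⟨⟨q, hqu.trans hu, hq⟩, u, hu, h⟩
  · rintro ⟨⟨u, hu, hua⟩, u', hu', hub⟩
    rcases List.prefix_or_prefix_of_prefix hu hu' with h | h
    · exact ⟨u', hu', Or.inr ⟨hub, u, hua, h⟩⟩
    · exact ⟨u, hu, Or.inl ⟨hua, u', hub, h⟩⟩

/-- If some prefix of `v :: w` is in the path semantics of `t`, then some prefix of `w` is in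
the path semantics of the residual of `t` after `v`. -/
theorem exists_prefix_mem_pathSem_residual {t t' : ATree σ} {v : σ} {w : List σ}
    (ht : t.residual v = some t') (h : ∃ u, u <+: v :: w ∧ u ∈ pathSem T t) :
    ∃ u, u <+: w ∧ u ∈ pathSem T t' := by
  induction t generalizing t' w with
  | leaf F =>
    obtain ⟨u, hu, hut⟩ := h
    by_cases hF : v ∈ F
    · simp [ATree.residual, hF] at ht
    obtain rfl : ATree.leaf F = t' := by simpa [ATree.residual, hF] using ht
    rcases List.prefix_cons_iff.1 hu with rfl | ⟨u, rfl, huw⟩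
    · exact absurd rfl hut.1.1
    obtain ⟨hp, s, hs, hl⟩ := hut
    have hne : u ≠ [] := by
      rintro rfl
      exact hF (by simp at hl; rwa [hl])
    rw [List.getLast?_cons_of_ne_nil hne] at hl
    exact ⟨u, huw, hp.of_suffix (List.suffix_cons v u) hne, s, hs, hl⟩
  | or a b iha ihb =>
    simp only [ATree.residual] at ht
    cases ha : a.residual v with
    | none => simp [ha] at ht
    | some a' =>
      cases hb : b.residual v with
      | none => simp [ha, hb] at ht
      | some b' =>
        simp only [ha, hb, Option.some.injEq] at ht
        subst ht
        obtain ⟨u, hu, h | h⟩ := h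
        · obtain ⟨u, hu, h⟩ := iha ha ⟨u, hu, h⟩
          exact ⟨u, hu, Or.inl h⟩
        · obtain ⟨u, hu, h⟩ := ihb hb ⟨u, hu, h⟩
          exact ⟨u, hu, Or.inr h⟩
  | sand a b iha ihb =>
    simp only [ATree.residual] at ht
    obtain ⟨u, hu, p, hp, q, hq, hpq, rfl⟩ := h
    have hpp := isTPath_of_mem_pathSem hp
    have hqp := isTPath_of_mem_pathSem hq
    cases ha : a.residual v with
    | none =>
      refine ihb (by simpa [ha] using ht) ⟨_, hu, ?_⟩
      have hpath := isTPath_append_tail hpp hqp hpq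
      rw [append_tail_eq hpp.1 hpq] at hpath ⊢
      exact append_mem_pathSem hq hpath
    | some a' =>
      simp only [ha, Option.some.injEq] at ht
      subst ht
      rcases List.prefix_cons_iff.1 ((List.prefix_append p q.tail).trans hu) with
        rfl | ⟨p, rfl, hpw⟩
      · exact absurd rfl hpp.1
      obtain ⟨p', ⟨y, rfl⟩, hp'⟩ := iha ha ⟨v :: p, List.prefix_rfl, hp⟩
      have hne := (isTPath_of_mem_pathSem hp').1
      obtain ⟨x, c, rfl⟩ := (List.eq_nil_or_concat p').resolve_left hne
      have hpath := isTPath_append_tail hpp hqp hpq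
      have key : c :: (y ++ q.tail) = (c :: y).dropLast ++ q := by
        rw [← List.cons_append]
        refine append_tail_eq (by simp) ?_
        rw [← hpq]
        have : v :: (x.concat c ++ y) = (v :: x) ++ (c :: y) := by simp
        rw [this, List.getLast?_append_of_ne_nil _ (by simp)]
      have hpath' : IsTPath T (c :: (y ++ q.tail)) :=
        hpath.of_suffix ⟨v :: x, by simp⟩ (by simp)
      refine ⟨x.concat c ++ (y ++ q.tail), ?_, x.concat c, hp', c :: (y ++ q.tail), ?_, ?_, ?_⟩
      · simpa using hu
      · rw [key] at hpath' ⊢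
        exact append_mem_pathSem hq hpath'
      · simp
      · simp
  | and a b iha ihb =>
    simp only [ATree.residual] at ht
    obtain ⟨h1, h2⟩ := exists_prefix_mem_pathSem_and.1 h
    cases ha : a.residual v with
    | none => exact ihb (by simpa [ha] using ht) h2
    | some a' =>
      cases hb : b.residual v with
      | none =>
        simp only [ha, hb, Option.some.injEq] at ht
        subst ht
        exact iha ha h1
      | some b' =>
        simp only [ha, hb, Option.some.injEq] at ht
        subst ht
        exact exists_prefix_mem_pathSem_and.2 ⟨iha ha h1, ihb hb h2⟩

/-- Reading a word with a prefix in the path semantics leaves the residual `none`. -/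
theorem residualWord_eq_none {t : ATree σ} {w : List σ}
    (h : ∃ u, u <+: w ∧ u ∈ pathSem T t) : residualWord (some t) w = none := by
  induction w generalizing t with
  | nil =>
    obtain ⟨u, hu, h⟩ := h
    exact absurd (List.prefix_nil.1 hu) (isTPath_of_mem_pathSem h).1
  | cons v w ih =>
    rw [residualWord_cons, residualStep_some]
    cases ht : t.residual v with
    | none => simp
    | some t' => exact ih (exists_prefix_mem_pathSem_residual ht h)

end PathSem

/-! ### The bounded reachability game on residuals -/

/-- Attacker can force, from position `p` and with residual `r` before reading `p`, that the
residual becomes `none` after reading at most `k` positions. -/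
def ForcesIn {Pos Act₁ Act₂ Prp : Type*} (A : Arena Pos Act₁ Act₂ Prp) :
    ℕ → Option (ATree Pos) → Pos → Prop
  | 0, r, _ => r = none
  | k + 1, r, p => ∃ a : Act₁, ∀ b : Act₂, ForcesIn A k (residualStep r p) (A.delta p (a, b))

section Forces

variable [Nonempty Act₁] {A : Arena Pos Act₁ Act₂ Prp}

theorem forcesIn_none (k : ℕ) (p : Pos) : ForcesIn A k none p := by
  induction k generalizing p with
  | zero => rfl
  | succ k ih => exact ⟨Classical.arbitrary _, fun b => ih _⟩

theorem ForcesIn.succ {k : ℕ} {r : Option (ATree Pos)} {p : Pos} (h : ForcesIn A k r p) :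
    ForcesIn A (k + 1) r p := by
  induction k generalizing r p with
  | zero =>
    obtain rfl : r = none := h
    exact forcesIn_none _ _
  | succ k ih =>
    obtain ⟨a, ha⟩ := h
    exact ⟨a, fun b => ih (ha b)⟩

theorem ForcesIn.mono {k l : ℕ} {r : Option (ATree Pos)} {p : Pos} (hkl : k ≤ l)
    (h : ForcesIn A k r p) : ForcesIn A l r p := by
  induction hkl with
  | refl => exact h
  | step _ ih => exact ih.succ

/-- If Attacker can force the residual to `none`, then within `|Pos|` times the number of
leaves of the tree. -/
theorem ForcesIn.card_mul_numLeaves [Fintype Pos] {k : ℕ} {t : ATree Pos} {p : Pos}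
    (h : ForcesIn A k (some t) p) :
    ForcesIn A (Fintype.card Pos * numLeaves t) (some t) p := by
  induction hn : numLeaves t using Nat.strong_induction_on generalizing t k p with
  | _ n ih =>
    subst hn
    set c := Fintype.card Pos
    set N := c * (numLeaves t - 1) with hN
    have hcN : c * numLeaves t = N + c := by
      obtain ⟨m, hm⟩ := Nat.exists_eq_succ_of_ne_zero (numLeaves_pos t).ne'
      rw [hN, hm]
      simp [Nat.mul_succ]
    let X : ℕ → Set Pos := fun j => {q | ForcesIn A (N + j) (some t) q}
    have hmono : Monotone X := fun i j hij q hq => ForcesIn.mono (by omega) hq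
    have hX : ∀ j, X j = X (j + 1) → X (j + 1) = X (j + 2) := by
      intro j hj
      refine (hmono (Nat.le_succ _)).antisymm ?_
      rintro q ⟨a, ha⟩
      refine ⟨a, fun b => ?_⟩
      specialize ha b
      rw [residualStep_some] at ha ⊢
      cases hq : t.residual q with
      | none => exact forcesIn_none _ _
      | some t' =>
        rw [hq] at ha
        rcases ATree.residual_eq_or_numLeaves_lt hq with rfl | hlt
        · have : A.delta q (a, b) ∈ X (j + 1) := ha
          rwa [← hj] at this
        · refine (ih _ hlt ha rfl).mono ?_
          have : c * numLeaves t' ≤ N := Nat.mul_le_mul_left c (by omega)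
          exact this.trans (Nat.le_add_right _ _)
    have hcard : ∀ n, c ≤ n → (X n).ncard = (X c).ncard := fun n hn =>
      Nat.stabilises_of_monotone (fun i j hij => Set.ncard_le_ncard (hmono hij))
        (fun m => by simpa [c, Nat.card_eq_fintype_card] using Set.ncard_le_card (X m))
        (fun m hm => by
          rw [← hX m (Set.eq_of_subset_of_ncard_le (hmono (Nat.le_succ _)) hm.ge)]) hn
    have hstab : X (max k c) = X c :=
      (Set.eq_of_subset_of_ncard_le (hmono (le_max_right _ _))
        (hcard _ (le_max_right _ _)).le).symm
    have hp : p ∈ X (max k c) := h.mono (by omega)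
    rw [hstab] at hp
    rw [hcN]
    exact hp

end Forces

/-! ### Histories, plays and strategies -/

theorem length_playPrefix (ρ : ℕ → Pos) (n : ℕ) : (playPrefix ρ n).length = n := by
  simp [playPrefix]

theorem playPrefix_succ (ρ : ℕ → Pos) (n : ℕ) :
    playPrefix ρ (n + 1) = playPrefix ρ n ++ [ρ n] := by
  simp [playPrefix, List.range_succ]

theorem head?_playPrefix (ρ : ℕ → Pos) {n : ℕ} (hn : 1 ≤ n) :
    (playPrefix ρ n).head? = some (ρ 0) := by
  obtain ⟨n, rfl⟩ := Nat.exists_eq_add_of_le' hn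
  simp [playPrefix, List.range_succ_eq_map]

theorem take_playPrefix (ρ : ℕ → Pos) {m n : ℕ} (h : m ≤ n) :
    (playPrefix ρ n).take m = playPrefix ρ m := by
  simp [playPrefix, ← List.map_take, List.take_range, h]

theorem eq_playPrefix_of_isPrefix {ρ : ℕ → Pos} {n : ℕ} {u : List Pos}
    (h : u <+: playPrefix ρ n) : u = playPrefix ρ u.length := by
  have hl : u.length ≤ n := by simpa [length_playPrefix] using h.length_le
  rw [← take_playPrefix ρ hl]
  exact List.prefix_iff_eq_take.1 h

section Consist

variable {Act : Type*} {A : Arena Pos Act₁ Act₂ Prp} {proj : Act₁ × Act₂ → Act}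
  {σ : List Pos → Act}

theorem ConsistHist.of_isPrefix {w u : List Pos} (h : ConsistHist A proj σ w) (hu : u <+: w) :
    ConsistHist A proj σ u := by
  obtain ⟨y, rfl⟩ := hu
  intro j hj
  obtain ⟨a, ha, ha'⟩ := h j (by simp; omega)
  rw [List.getElem_append_left (by omega), List.getElem_append_left hj] at ha
  rw [List.take_append_of_le_length (by omega)] at ha'
  exact ⟨a, ha, ha'⟩

theorem ConsistHist.concat {w : List Pos} {q : Pos} (h : ConsistHist A proj σ w)
    (hq : ∀ p ∈ w.getLast?, ∃ a, A.delta p a = q ∧ proj a = σ w) :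
    ConsistHist A proj σ (w ++ [q]) := by
  intro j hj
  have hj' : j + 1 ≤ w.length := by simpa using hj
  rcases hj'.lt_or_eq with hlt | heq
  · obtain ⟨a, ha, ha'⟩ := h j hlt
    refine ⟨a, ?_, ?_⟩
    · rw [List.getElem_append_left (by omega), List.getElem_append_left hlt]
      exact ha
    · rw [List.take_append_of_le_length hj']
      exact ha'
  · obtain ⟨a, ha, ha'⟩ := hq (w[j]) (by
      rw [List.getLast?_eq_getElem?, ← heq]
      simp)
    refine ⟨a, ?_, ?_⟩
    · rw [List.getElem_append_left (by omega), ha]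
      simp [heq]
    · rw [List.take_append_of_le_length hj', heq, List.take_length]
      exact ha'

theorem ConsistPlay.exists_action {ρ : ℕ → Pos} (h : ConsistPlay A proj σ ρ) (i : ℕ) :
    ∃ a, A.delta (ρ i) a = ρ (i + 1) ∧ proj a = σ (playPrefix ρ (i + 1)) := by
  obtain ⟨a, ha, ha'⟩ := h (i + 2) i (by simp [length_playPrefix])
  rw [take_playPrefix ρ (by omega)] at ha'
  exact ⟨a, by simpa [playPrefix] using ha, ha'⟩

theorem ConsistPlay.isPlay {ρ : ℕ → Pos} (h : ConsistPlay A proj σ ρ) : IsPlay A ρ := fun i => by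
  obtain ⟨a, ha, -⟩ := h.exists_action i
  exact ⟨a, ha.symm⟩

theorem ConsistHist.isTPath {w : List Pos} (h : ConsistHist A proj σ w) (hne : w ≠ []) :
    IsTPath (arenaTS A) w := by
  refine ⟨hne, List.isChain_iff_getElem.2 fun j hj => ?_⟩
  obtain ⟨a, ha, -⟩ := h j hj
  exact ⟨a, ha⟩

end Consist

section Attacker

variable {A : Arena Pos Act₁ Act₂ Prp} {σ : List Pos → Act₁}

/-- Every consistent history extends to a consistent play. -/
theorem ConsistHist.exists_consistPlay [Nonempty Act₂] {w : List Pos}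
    (h : ConsistHist A Prod.fst σ w) (hne : w ≠ []) :
    ∃ ρ, ConsistPlay A Prod.fst σ ρ ∧ w = playPrefix ρ w.length := by
  let p₀ := w.head hne
  let b₀ : Act₂ := Classical.arbitrary _
  let H : ℕ → List Pos := Nat.rec w fun _ u => u ++ [A.delta (u.getLastD p₀) (σ u, b₀)]
  have hH : ∀ n, H (n + 1) = H n ++ [A.delta ((H n).getLastD p₀) (σ (H n), b₀)] := fun _ => rfl
  have hlen : ∀ n, (H n).length = w.length + n := by
    intro n
    induction n with
    | zero => rfl
    | succ n ih => rw [hH, List.length_append, ih]; simp [Nat.add_assoc]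
  have hpre : ∀ {m n}, m ≤ n → H m <+: H n := by
    intro m n hmn
    induction hmn with
    | refl => exact List.prefix_rfl
    | step _ ih => exact ih.trans (List.prefix_append _ _)
  have hcons : ∀ n, ConsistHist A Prod.fst σ (H n) := by
    intro n
    induction n with
    | zero => exact h
    | succ n ih =>
      rw [hH]
      refine ih.concat fun p hp => ⟨(σ (H n), b₀), ?_, rfl⟩
      rw [List.getLastD_eq_getLast?, Option.mem_def.1 hp, Option.getD_some]
  let ρ : ℕ → Pos := fun i => (H i).getD i p₀
  have hpos : 0 < w.length := List.length_pos_iff.2 hne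
  have hρ : ∀ i k (hi : i < (H k).length), ρ i = (H k)[i] := by
    intro i k hi
    have hi' : i < (H i).length := by rw [hlen]; omega
    have hρi : ρ i = (H i)[i] := List.getD_eq_getElem _ _ hi'
    rw [hρi]
    rcases le_total i k with hik | hik
    · exact (hpre hik).getElem hi'
    · exact ((hpre hik).getElem hi).symm
  have hplay : ∀ n k, n ≤ (H k).length → playPrefix ρ n = (H k).take n := by
    intro n k hn
    refine List.ext_getElem (by simpa [length_playPrefix] using hn) fun i h₁ h₂ => ?_
    rw [List.getElem_take, ← hρ]
    simp [playPrefix]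
  refine ⟨ρ, fun n => ?_, ?_⟩
  · rw [hplay n n (by rw [hlen]; omega)]
    exact (hcons n).of_isPrefix (⟨_, List.take_append_drop _ _⟩)
  · exact ((hplay w.length 0 le_rfl).trans List.take_length).symm

theorem mem_STree_iff [Nonempty Act₂] {v : Pos} {w : List Pos} :
    w ∈ STree A Prod.fst σ v ↔ w.head? = some v ∧ ConsistHist A Prod.fst σ w := by
  constructor
  · rintro ⟨⟨ρ, -, hρ, n, -, hw⟩, ρ', -, rfl, n', hn', hw'⟩
    exact ⟨hw' ▸ head?_playPrefix ρ' hn', hw ▸ hρ n⟩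
  · rintro ⟨hv, hw⟩
    have hne : w ≠ [] := by rintro rfl; simp at hv
    obtain ⟨ρ, hρ, hwρ⟩ := hw.exists_consistPlay hne
    have hlen : 1 ≤ w.length := List.length_pos_iff.2 hne
    refine ⟨⟨ρ, hρ.isPlay, hρ, _, hlen, hwρ⟩, ρ, hρ.isPlay, ?_, _, hlen, hwρ⟩
    rw [hwρ, head?_playPrefix ρ hlen] at hv
    simpa using hv

/-- From a finite tree of the strategy semantics, Attacker can force the residual to `none`. -/
theorem exists_forcesIn_of_stratSem_nonempty [Nonempty Act₁] [Nonempty Act₂] {t : ATree Pos}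
    (h : (stratSem A t).Nonempty) : ∃ v k, ForcesIn A k (some t) v := by
  obtain ⟨S, ⟨σ, v, ⟨_, ⟨v₀, hv₀, hv₀'⟩, hsub, hchild⟩⟩, hfin, -, hleaf⟩ := h
  obtain ⟨N, hN⟩ := (hfin.image List.length).bddAbove
  have key : ∀ k x p, x ++ [p] ∈ S → N < x.length + 1 + k →
      ForcesIn A k (residualWord (some t) x) p := by
    intro k
    induction k with
    | zero =>
      intro x p hx hk
      have : (x ++ [p]).length ≤ N := hN ⟨_, hx, rfl⟩
      simp at this
      omega
    | succ k ih =>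
      intro x p hx hk
      refine ⟨σ (x ++ [p]), fun b => ?_⟩
      have hres : residualStep (residualWord (some t) x) p = residualWord (some t) (x ++ [p]) := by
        rw [residualWord_append, residualWord_singleton]
      rw [hres]
      by_cases hl : IsLeafOf S (x ++ [p])
      · rw [residualWord_eq_none ⟨_, List.prefix_rfl, hleaf _ hl⟩]
        exact forcesIn_none _ _
      · refine ih _ _ ?_ (by simp; omega)
        have hmem := hchild _ hx hl
        set q := A.delta p (σ (x ++ [p]), b) with hq
        obtain ⟨hv, hc⟩ := mem_STree_iff.1 (hsub hx)
        have hext : (x ++ [p]) ++ [q] ∈ STree A Prod.fst σ v := by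
          refine mem_STree_iff.2 ⟨by rw [List.head?_append, hv]; rfl, hc.concat fun p' hp' => ?_⟩
          obtain rfl : p = p' := by simpa using hp'
          exact ⟨_, hq.symm, rfl⟩
        have : (x ++ [p]) ++ [q] ∈ childrenOf (STree A Prod.fst σ v) (x ++ [p]) := by
          refine ⟨hext, List.prefix_append _ _, by simp, fun u _ hu hu' => ?_⟩
          rcases List.prefix_concat_iff.1 hu' with h | h
          · exact Or.inr h
          · exact Or.inl (h.eq_of_length_le hu.length_le)
        rw [← hmem] at this
        exact this.1
  exact ⟨v₀, N + 1, key (N + 1) [] v₀ hv₀ (by simp; omega)⟩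

/-- If Attacker can force the residual to `none` in `k` steps, then some strategy ensures that
every play matches the tree within `k` positions. -/
theorem ForcesIn.exists_strategy [Nonempty Act₁] {k : ℕ} {t : ATree Pos} {v : Pos}
    (h : ForcesIn A k (some t) v) :
    ∃ σ : List Pos → Act₁, ∀ ρ : ℕ → Pos, ConsistPlay A Prod.fst σ ρ → ρ 0 = v →
      ∃ m : ℕ, 1 ≤ m ∧ m ≤ k ∧ playPrefix ρ m ∈ pathSem (arenaTS A) t := by
  have hchoice : ∀ u : List Pos, ∃ a : Act₁,
      (∃ a, ∀ b, ForcesIn A (k - u.length) (residualWord (some t) u)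
        (A.delta (u.getLastD v) (a, b))) →
      ∀ b, ForcesIn A (k - u.length) (residualWord (some t) u)
        (A.delta (u.getLastD v) (a, b)) := by
    intro u
    by_cases hu : ∃ a, ∀ b, ForcesIn A (k - u.length) (residualWord (some t) u)
        (A.delta (u.getLastD v) (a, b))
    · obtain ⟨a, ha⟩ := hu
      exact ⟨a, fun _ => ha⟩
    · exact ⟨Classical.arbitrary _, fun h => absurd h hu⟩
  choose σ hσ using hchoice
  refine ⟨σ, fun ρ hρ hv => ?_⟩
  have inv : ∀ i ≤ k, ForcesIn A (k - i) (residualWord (some t) (playPrefix ρ i)) (ρ i) := by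
    intro i
    induction i with
    | zero => intro _; rw [hv]; exact h
    | succ i ih =>
      intro hi
      have hf := ih (by omega)
      rw [show k - i = (k - (i + 1)) + 1 by omega] at hf
      have hlast : (playPrefix ρ (i + 1)).getLastD v = ρ i := by
        rw [playPrefix_succ, List.getLastD_concat]
      have hres : residualStep (residualWord (some t) (playPrefix ρ i)) (ρ i) =
          residualWord (some t) (playPrefix ρ (i + 1)) := by
        rw [playPrefix_succ, residualWord_append, residualWord_singleton]
      have hs := hσ (playPrefix ρ (i + 1))
      rw [hlast, length_playPrefix] at hs
      obtain ⟨a, ha, ha'⟩ := hρ.exists_action i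
      change ∃ a : Act₁, ∀ b : Act₂, ForcesIn A _ _ _ at hf
      rw [hres] at hf
      have := hs hf a.2
      rwa [← ha', Prod.mk.eta, ha] at this
  have hnone : residualWord (some t) (playPrefix ρ k) = none := by
    have := inv k le_rfl
    rwa [Nat.sub_self] at this
  have hne : playPrefix ρ k ≠ [] := by
    intro h0
    simp [h0] at hnone
  obtain ⟨u, hu, hut⟩ := exists_prefix_mem_pathSem ((hρ k).isTPath hne) hnone
  refine ⟨u.length, List.length_pos_iff.2 (isTPath_of_mem_pathSem hut).1, ?_, ?_⟩
  · simpa [length_playPrefix] using hu.length_le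
  · rwa [← eq_playPrefix_of_isPrefix hu]

/-- If every play consistent with a strategy matches the tree within a bounded number of
positions, then the strategy semantics is nonempty. -/
theorem stratSem_nonempty_of_strategy [Finite Pos] [Nonempty Act₂] {t : ATree Pos} {v : Pos}
    {K : ℕ} (h : ∀ ρ : ℕ → Pos, ConsistPlay A Prod.fst σ ρ → ρ 0 = v →
      ∃ m : ℕ, 1 ≤ m ∧ m ≤ K ∧ playPrefix ρ m ∈ pathSem (arenaTS A) t) :
    (stratSem A t).Nonempty := by
  set R := STree A Prod.fst σ v with hR
  let S : Set (List Pos) :=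
    {w | w ∈ R ∧ ∀ u, u <+: w → u ≠ w → u ∉ pathSem (arenaTS A) t}
  have hne : ∀ w ∈ R, w ≠ [] := by
    rintro w hw rfl
    simpa using (mem_STree_iff.1 hw).1
  have hRpre : ∀ w ∈ R, ∀ u, u <+: w → u ≠ [] → u ∈ R := by
    intro w hw u hu hu0
    obtain ⟨hv, hc⟩ := mem_STree_iff.1 hw
    refine mem_STree_iff.2 ⟨?_, hc.of_isPrefix hu⟩
    rw [← hv]
    obtain ⟨y, rfl⟩ := hu
    exact (List.head?_append_of_ne_nil _ hu0).symm
  have hSpre : ∀ w ∈ S, ∀ u, u <+: w → u ≠ [] → u ∈ S := by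
    rintro w ⟨hw, hwt⟩ u hu hu0
    refine ⟨hRpre w hw u hu hu0, fun x hx hxu => hwt x (hx.trans hu) ?_⟩
    rintro rfl
    exact hxu (hx.eq_of_length_le hu.length_le)
  have hroot : [v] ∈ S := by
    refine ⟨mem_STree_iff.2 ⟨rfl, fun j hj => by simp at hj⟩, fun u hu hu' hut => ?_⟩
    rcases List.prefix_concat_iff (l₂ := []).1 hu with rfl | h0
    · exact hu' rfl
    · exact (isTPath_of_mem_pathSem hut).1 (List.prefix_nil.1 h0)
  have htree : IsSTree S :=
    ⟨⟨_, hroot⟩, fun w hw => hne w hw.1, hSpre, v, fun w hw => (mem_STree_iff.1 hw.1).1⟩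
  have hfin : S.Finite := by
    refine (List.finite_length_le Pos K).subset ?_
    rintro w ⟨hw, hwt⟩
    obtain ⟨hv, hc⟩ := mem_STree_iff.1 hw
    obtain ⟨ρ, hρ, hwρ⟩ := hc.exists_consistPlay (hne w hw)
    have hlen : 1 ≤ w.length := List.length_pos_iff.2 (hne w hw)
    obtain ⟨m, -, hmK, hmt⟩ := h ρ hρ (by
      rw [hwρ, head?_playPrefix ρ hlen] at hv
      simpa using hv)
    by_contra hK
    have hlt : m < w.length := by
      have : ¬ w.length ≤ K := hK
      omega
    refine hwt (playPrefix ρ m) ?_ ?_ hmt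
    · rw [hwρ, ← take_playPrefix ρ hlt.le]
      exact ⟨_, List.take_append_drop _ _⟩
    · intro he
      have := congrArg List.length he
      rw [length_playPrefix] at this
      omega
  have hchildren : ∀ w ∈ S, w ∉ pathSem (arenaTS A) t → childrenOf S w = childrenOf R w := by
    intro w hw hwt
    ext w'
    constructor
    · rintro ⟨hw', hpre, hne', hmin⟩
      exact ⟨hw'.1, hpre, hne', fun u hu hwu huw' =>
        hmin u (hSpre w' hw' u huw' (hne u hu)) hwu huw'⟩
    · rintro ⟨hw', hpre, hne', hmin⟩
      refine ⟨⟨hw', fun u hu huw' hut => ?_⟩, hpre, hne', fun u hu => hmin u hu.1⟩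
      have hu0 := (isTPath_of_mem_pathSem hut).1
      rcases List.prefix_or_prefix_of_prefix hu hpre with hc | hc
      · by_cases huw : u = w
        · exact hwt (huw ▸ hut)
        · exact hw.2 u hc huw hut
      · rcases hmin u (hRpre w' hw' u hu hu0) hc hu with rfl | rfl
        · exact hwt hut
        · exact huw' rfl
  refine ⟨S, ⟨σ, v, htree, ⟨v, hroot, hroot.1⟩, fun w hw => hw.1, ?_⟩, hfin, htree, ?_⟩
  · intro w hw hl
    refine hchildren w hw fun hwt => hl ⟨hw, fun w' hw' hpre => ?_⟩
    by_contra hne'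
    exact hw'.2 w hpre (Ne.symm hne') hwt
  · intro w hl
    by_contra hwt
    obtain ⟨hv, hc⟩ := mem_STree_iff.1 hl.1.1
    obtain ⟨ρ, hρ, hwρ⟩ := hc.exists_consistPlay (hne w hl.1.1)
    have hlen : 1 ≤ w.length := List.length_pos_iff.2 (hne w hl.1.1)
    have hext : w ++ [ρ w.length] ∈ R := by
      refine mem_STree_iff.2 ⟨by rw [List.head?_append, hv]; rfl, ?_⟩
      have := hρ (w.length + 1)
      rwa [playPrefix_succ, ← hwρ] at this
    have hS : w ++ [ρ w.length] ∈ S := by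
      refine ⟨hext, fun u hu hu' hut => ?_⟩
      rcases List.prefix_concat_iff.1 hu with h | h
      · exact hu' h
      · by_cases huw : u = w
        · exact hwt (huw ▸ hut)
        · exact hl.1.2 u h huw hut
    have := hl.2 _ hS (List.prefix_append _ _)
    simp at this

end Attacker

theorem stratSem_nonempty_iff {Pos Act₁ Act₂ Prp : Type*}
    [Fintype Pos] [Nonempty Pos] [Finite Act₁] [Nonempty Act₁] [Finite Act₂] [Nonempty Act₂]
    (A : Arena Pos Act₁ Act₂ Prp) (t : ATree Pos) :
    (stratSem A t).Nonempty ↔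
      ∃ (v : Pos) (σ : List Pos → Act₁), ∀ ρ : ℕ → Pos,
        IsPlay A ρ → ConsistPlay A Prod.fst σ ρ → ρ 0 = v →
          ∃ m : ℕ, 1 ≤ m ∧ m ≤ Fintype.card Pos * numLeaves t ∧
            playPrefix ρ m ∈ pathSem (arenaTS A) t := by
  constructor
  · intro h
    obtain ⟨v, k, hk⟩ := exists_forcesIn_of_stratSem_nonempty h
    obtain ⟨σ, hσ⟩ := hk.card_mul_numLeaves.exists_strategy
    exact ⟨v, σ, fun ρ _ => hσ ρ⟩
  · rintro ⟨v, σ, h⟩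
    exact stratSem_nonempty_of_strategy fun ρ hρ => h ρ hρ.isPlay hρ
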